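/- Let q ≤ n and let f ∈ H_d^ℝ[q] be nonzero. Then the map S^n → [0,1], y ↦ 1/K(f,y) := max{ ‖f(y)‖₂ , σ_q(Δ⁻¹D_yf) } / (√q·‖f‖∞), is D-Lipschitz with respect to the geodesic distance on the sphere; that is, for all y, ỹ ∈ S^n, |1/K(f,y) − 1/K(f,ỹ)| ≤ D · arccos⟨y,ỹ⟩, where D := max_i dᵢ. -/

import Mathlib

open MvPolynomial

noncomputable def vnorm {m : ℕ} (v : Fin m → ℝ) : ℝ := Real.sqrt (∑ j, v j ^ 2)

noncomputable def polySupNorm {n q : ℕ} (f : Fin q → MvPolynomial (Fin (n + 1)) ℝ) : ℝ :=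
  ⨆ x : {x : Fin (n + 1) → ℝ // vnorm x = 1}, ⨆ i : Fin q, |eval x.1 (f i)|

/-- The smallest singular value `σ_q(Δ⁻¹D_yg)` of the scaled derivative of `g` at `y`
restricted to the tangent space `T_ySⁿ = y^⊥`. -/
noncomputable def sigmaMin {n q : ℕ} (d : Fin q → ℕ) (y : Fin (n + 1) → ℝ)
    (g : Fin q → MvPolynomial (Fin (n + 1)) ℝ) : ℝ :=
  ⨅ u : {u : Fin q → ℝ // vnorm u = 1},
    ⨆ w : {w : Fin (n + 1) → ℝ // vnorm w ≤ 1 ∧ ∑ j, w j * y j = 0},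
      |∑ i, u.1 i * ((d i : ℝ)⁻¹ * ∑ j, w.1 j * eval y (pderiv j (g i)))|

/-- `Φ_y(g) = max{‖g(y)‖₂, σ_q(Δ⁻¹D_yg)}`, so that `1/K(g,y) = Φ_y(g)/(√q ‖g‖∞)`. -/
noncomputable def Phi {n q : ℕ} (d : Fin q → ℕ) (y : Fin (n + 1) → ℝ)
    (g : Fin q → MvPolynomial (Fin (n + 1)) ℝ) : ℝ :=
  max (vnorm fun i => eval y (g i)) (sigmaMin d y g)


theorem rz_sum (d : ℕ) (hd : 1 ≤ d) (η : ℂ) (hη : IsPrimitiveRoot η (2 * d)) (hηd : η ^ d = -1)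
    (l : ℕ) (hl : 0 < l) (hl2 : l < 2 * d) :
    ∑ k ∈ Finset.range d, (η ^ (2 * k + 1)) ^ l = if l = d then -(d : ℂ) else 0 := by
  split_ifs with h
  · subst h
    have : ∀ k ∈ Finset.range l, (η ^ (2 * k + 1)) ^ l = -1 := by
      intro k _
      rw [← pow_mul, mul_comm, pow_mul, hηd, pow_add, pow_mul]; simp
    rw [Finset.sum_congr rfl this]; simp
  · have h1 : (η ^ (2 * l)) ≠ 1 := by
      intro h2
      have h3 := (hη.pow_eq_one_iff_dvd _).1 h2
      have h4 : d ∣ l := (Nat.mul_dvd_mul_iff_left (by norm_num)).1 h3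
      obtain ⟨c, rfl⟩ := h4
      have : c < 2 := by
        by_contra hc
        push Not at hc
        nlinarith
      interval_cases c <;> simp_all
    have h2 : ∀ k ∈ Finset.range d, (η ^ (2 * k + 1)) ^ l = η ^ l * (η ^ (2 * l)) ^ k := by
      intro k _
      rw [← pow_mul, ← pow_mul, ← pow_add]; congr 1; ring
    rw [Finset.sum_congr rfl h2, ← Finset.mul_sum, geom_sum_eq h1]
    have : (η ^ (2 * l)) ^ d = 1 := by
      rw [← pow_mul, show 2 * l * d = (2 * d) * l by ring, pow_mul, hη.pow_eq_one, one_pow]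
    rw [this]; simp

theorem rz_diff (d : ℕ) (hd : 1 ≤ d) (η : ℂ) (hη : IsPrimitiveRoot η (2 * d)) (hηd : η ^ d = -1)
    (j : ℕ) (hj : j < d) :
    ∑ k ∈ Finset.range d, (η ^ (2 * k + 1)) ^ (j + 1) *
      ∑ a ∈ Finset.range d, (η ^ (2 * k + 1)) ^ a = -(d : ℂ) := by
  simp_rw [Finset.mul_sum, ← pow_add (η ^ _)]
  rw [Finset.sum_comm]
  rw [Finset.sum_congr rfl (fun a ha => rz_sum d hd η hη hηd (j + 1 + a) (by omega)
    (by have := Finset.mem_range.1 ha; omega))]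
  rw [Finset.sum_eq_single (d - 1 - j)]
  · rw [if_pos (by omega)]
  · intro b _ hb
    rw [if_neg (by omega)]
  · intro h; exact absurd (Finset.mem_range.2 (by omega)) h

theorem rz_nodes (d : ℕ) (hd : 1 ≤ d) : ∃ (s : ℕ → ℝ) (b : ℕ → ℝ),
    (∀ k, 0 ≤ b k) ∧ ∀ j ≤ d,
      ∑ k ∈ Finset.range d, (b k : ℂ) * (Complex.exp (s k * Complex.I) ^ 2) ^ j = d - 2 * j := by
  set η : ℂ := Complex.exp (2 * Real.pi * Complex.I / ((2 * d : ℕ) : ℂ)) with hηdef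
  have hd0 : (d : ℂ) ≠ 0 := by exact_mod_cast (by omega : d ≠ 0)
  have hη : IsPrimitiveRoot η (2 * d) := Complex.isPrimitiveRoot_exp _ (by omega)
  have hηd : η ^ d = -1 := by
    rw [hηdef, ← Complex.exp_nat_mul, ← Complex.exp_pi_mul_I]
    congr 1; push_cast; field_simp
  have hηn : ‖η‖ = 1 := hη.norm'_eq_one (by omega)
  let ζ : ℕ → ℂ := fun k => η ^ (2 * k + 1)
  let S : ℕ → ℂ := fun k => ∑ a ∈ Finset.range d, ζ k ^ a
  have hζn : ∀ k, ‖ζ k‖ = 1 := fun k => by simp [ζ, hηn]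
  have hζd : ∀ k, ζ k ^ d = -1 := by
    intro k
    simp only [ζ]
    rw [← pow_mul, mul_comm, pow_mul, hηd, pow_add, pow_mul]; simp
  have hS : ∀ k, S k * (ζ k - 1) = -2 := by
    intro k
    simp only [S]; rw [geom_sum_mul, hζd]; norm_num
  have hζ0 : ∀ k, ζ k ≠ 0 := fun k h => by have := hζn k; rw [h] at this; simp at this
  have hb : ∀ k, ((‖S k‖ ^ 2 / d : ℝ) : ℂ) = -(1 / d) * (ζ k * S k ^ 2) := by
    intro k
    have h1 : ((‖S k‖ ^ 2 : ℝ) : ℂ) = S k * (starRingEnd ℂ) (S k) := by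
      rw [Complex.mul_conj, Complex.normSq_eq_norm_sq]
    have h2 : ζ k * (starRingEnd ℂ) (ζ k) = 1 := by
      rw [Complex.mul_conj, Complex.normSq_eq_norm_sq, hζn]; simp
    have h3 : (starRingEnd ℂ) (S k) * ((starRingEnd ℂ) (ζ k) - 1) = -2 := by
      have := congrArg (starRingEnd ℂ) (hS k)
      simpa [map_ofNat] using this
    have h4 : (starRingEnd ℂ) (S k) = - (ζ k * S k) := by
      have h5 : ζ k - 1 ≠ 0 := by
        intro h; have := hS k; rw [h] at this; norm_num at this
      have h6 : (starRingEnd ℂ) (S k) * (1 - ζ k) = -2 * ζ k := by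
        linear_combination ζ k * h3 - (starRingEnd ℂ) (S k) * h2
      apply mul_right_cancel₀ h5
      linear_combination - h6 + ζ k * hS k
    rw [Complex.ofReal_div, h1, h4]; push_cast; ring
  have key : ∀ j, j ≤ d → ∑ k ∈ Finset.range d, ((‖S k‖ ^ 2 / d : ℝ) : ℂ) * ζ k ^ j
      = (∑ k ∈ Finset.range d, ((‖S k‖ ^ 2 / d : ℝ) : ℂ)) - 2 * j := by
    intro j
    induction j with
    | zero => intro _; simp
    | succ j ih =>
      intro hj
      have h1 := ih (by omega)
      have h2 := rz_diff d hd η hη hηd j (by omega)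
      have h3 : ∑ k ∈ Finset.range d, (((‖S k‖ ^ 2 / d : ℝ) : ℂ) * ζ k ^ (j + 1)
          - ((‖S k‖ ^ 2 / d : ℝ) : ℂ) * ζ k ^ j) = (2 / d) * (∑ k ∈ Finset.range d, (η ^ (2 * k + 1)) ^ (j + 1) *
            ∑ a ∈ Finset.range d, (η ^ (2 * k + 1)) ^ a) := by
        rw [Finset.mul_sum]
        refine Finset.sum_congr rfl fun k _ => ?_
        change _ = 2 / (d : ℂ) * (ζ k ^ (j + 1) * S k)
        rw [hb]
        linear_combination (-(1 / (d : ℂ)) * ζ k ^ (j+1) * S k) * hS k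
      rw [h2, Finset.sum_sub_distrib, h1] at h3
      have h4 : 2 / (d : ℂ) * -d = -2 := by field_simp
      rw [h4] at h3
      push_cast at h3 ⊢
      linear_combination h3
  have hB0 : ∑ k ∈ Finset.range d, ((‖S k‖ ^ 2 / d : ℝ) : ℂ) = d := by
    have h1 := key d le_rfl
    simp_rw [hζd] at h1
    rw [← Finset.sum_mul] at h1
    linear_combination (-1/2 : ℂ) * h1
  refine ⟨fun k => (2 * k + 1) * Real.pi / (2 * d), fun k => ‖S k‖ ^ 2 / d,
    fun k => by positivity, fun j hj => ?_⟩
  rw [← hB0, ← key j hj]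
  refine Finset.sum_congr rfl fun k _ => ?_
  congr 2
  simp only [ζ, hηdef]
  rw [← Complex.exp_nat_mul, ← Complex.exp_nat_mul]
  congr 1; push_cast; field_simp

theorem hom_eval_smul {σ : Type*} {R : Type*} [CommSemiring R] (F : MvPolynomial σ R) (d : ℕ)
    (hF : F.IsHomogeneous d) (s : R) (x : σ → R) :
    eval (fun i => s * x i) F = s ^ d * eval x F := by
  rw [eval_eq, eval_eq, Finset.mul_sum]
  refine Finset.sum_congr rfl fun m hm => ?_
  have h := hF (mem_support_iff.1 hm)
  have : ∑ i ∈ m.support, m i = d := by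
    rw [← h, Finsupp.weight_apply]; simp [Finsupp.sum]
  simp_rw [mul_pow, Finset.prod_mul_distrib, Finset.prod_pow_eq_pow_sum]
  rw [this]; ring

theorem deriv_aeval {σ : Type*} [Fintype σ] (F : MvPolynomial σ ℂ) (g : σ → Polynomial ℂ) :
    Polynomial.derivative (aeval g F) =
      ∑ j, Polynomial.derivative (g j) * aeval g (pderiv j F) := by
  classical
  induction F using MvPolynomial.induction_on with
  | C a => simp
  | add p q hp hq => simp [hp, hq, mul_add, Finset.sum_add_distrib]
  | mul_X p i hp =>
    have h : ∀ j, Polynomial.derivative (g j) * aeval g (pderiv j (p * X i)) =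
        (Polynomial.derivative (g j) * aeval g (pderiv j p)) * g i +
          if j = i then aeval g p * Polynomial.derivative (g j) else 0 := by
      intro j
      rw [pderiv_mul, map_add, map_mul, map_mul, aeval_X]
      split_ifs with hji
      · subst hji
        rw [pderiv_X_self, map_one]; ring
      · rw [pderiv_X_of_ne (Ne.symm hji), map_zero]; ring
    rw [Finset.sum_congr rfl (fun j _ => h j), Finset.sum_add_distrib, ← Finset.sum_mul, ← hp,
      map_mul, aeval_X, Polynomial.derivative_mul]
    simp

theorem bernstein_circle {σ : Type*} [Fintype σ] (f : MvPolynomial σ ℝ) (d : ℕ) (hd : 1 ≤ d)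
    (hf : f.IsHomogeneous d) (y v : σ → ℝ) (M : ℝ)
    (hM : ∀ a b : ℝ, a ^ 2 + b ^ 2 = 1 → |eval (fun j => a * y j + b * v j) f| ≤ M) :
    |∑ j, v j * eval y (pderiv j f)| ≤ d * M := by
  obtain ⟨s, b, hb, hj⟩ := rz_nodes d hd
  set F : MvPolynomial σ ℂ := map (algebraMap ℝ ℂ) f with hFdef
  have hFh : F.IsHomogeneous d := hf.map _
  have hev : ∀ (p : MvPolynomial σ ℝ) (x : σ → ℝ),
      eval (fun j => (x j : ℂ)) (map (algebraMap ℝ ℂ) p) = ((eval x p : ℝ) : ℂ) := by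
    intro p x
    rw [eval_map, ← Complex.coe_algebraMap]
    exact (eval₂_comp (algebraMap ℝ ℂ) x p).symm
  let g : σ → Polynomial ℂ := fun j =>
    Polynomial.C ((y j - v j * Complex.I) / 2) * Polynomial.X +
      Polynomial.C ((y j + v j * Complex.I) / 2)
  have hge : ∀ (p : MvPolynomial σ ℂ) (z : ℂ), (aeval g p).eval z = eval (fun j => (g j).eval z) p := by
    intro p z
    induction p using MvPolynomial.induction_on with
    | C a => simp
    | add p q hp hq => simp [hp, hq]
    | mul_X p i hp => simp [hp]
  set Q : Polynomial ℂ := aeval g F with hQ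
  have hQdeg : Q.natDegree ≤ d := by
    have := MvPolynomial.aeval_natDegree_le F hFh.totalDegree_le g (n := 1)
      (fun i => Polynomial.natDegree_linear_le)
    simpa using this
  -- evaluation at nodes
  have hQn : ∀ t : ℝ, ‖Q.eval (Complex.exp (t * Complex.I) ^ 2)‖ ≤ M := by
    intro t
    have h1 : ∀ j, (g j).eval (Complex.exp (t * Complex.I) ^ 2) =
        Complex.exp (t * Complex.I) * ((Real.cos t * y j + Real.sin t * v j : ℝ) : ℂ) := by
      intro j
      have hcs : (Complex.cos t) ^ 2 + (Complex.sin t) ^ 2 = 1 := Complex.cos_sq_add_sin_sq _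
      simp only [g, Polynomial.eval_add, Polynomial.eval_mul, Polynomial.eval_C, Polynomial.eval_X]
      rw [Complex.exp_mul_I]
      push_cast
      linear_combination (-(y j + v j * Complex.I) / 2 : ℂ) * hcs +
        ((y j - v j * Complex.I) / 2 * (Complex.sin t) ^ 2 - v j * Complex.cos t * Complex.sin t) * Complex.I_sq
    rw [hQ, hge]
    simp_rw [h1]
    rw [hom_eval_smul F d hFh, hFdef, hev, norm_mul, norm_pow, Complex.norm_exp_ofReal_mul_I]
    simpa using hM _ _ (Real.cos_sq_add_sin_sq t)
  have hQid : ∑ k ∈ Finset.range d, (b k : ℂ) * Q.eval (Complex.exp (s k * Complex.I) ^ 2)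
      = d * Q.eval 1 - 2 * (Polynomial.derivative Q).eval 1 := by
    have hlt : Q.natDegree < d + 1 := by omega
    simp_rw [Polynomial.eval_eq_sum_range' hlt, Finset.mul_sum]
    rw [Finset.sum_comm, Polynomial.derivative_eval, Polynomial.sum_over_range' _ _ (d+1) hlt,
      Finset.mul_sum, ← Finset.sum_sub_distrib]
    · refine Finset.sum_congr rfl fun i hi => ?_
      have h1 := hj i (by have := Finset.mem_range.1 hi; omega)
      have h2 : ∑ k ∈ Finset.range d, (b k : ℂ) * (Q.coeff i * (Complex.exp (s k * Complex.I) ^ 2) ^ i)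
          = Q.coeff i * (d - 2 * i) := by
        rw [← h1, Finset.mul_sum]
        exact Finset.sum_congr rfl fun _ _ => by ring
      rw [h2]; simp; ring
    · simp
  have hg1 : ∀ j, (g j).eval 1 = (y j : ℂ) := by
    intro j; simp [g]; ring
  have hQ1 : Q.eval 1 = ((eval y f : ℝ) : ℂ) := by
    rw [hQ, hge]; simp_rw [hg1]; rw [hFdef, hev]
  have hEuler : ∑ j, y j * eval y (pderiv j f) = d * eval y f := by
    have := congrArg (eval y) hf.sum_X_mul_pderiv
    simpa using this
  have hQ' : (Polynomial.derivative Q).eval 1 =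
      (d * ((eval y f : ℝ) : ℂ) - ((∑ j, v j * eval y (pderiv j f) : ℝ) : ℂ) * Complex.I) / 2 := by
    rw [hQ, deriv_aeval, Polynomial.eval_finsetSum]
    have : ∀ j, Polynomial.eval 1 (Polynomial.derivative (g j) * aeval g (pderiv j F)) =
        ((y j * eval y (pderiv j f) : ℝ) : ℂ) / 2 -
        ((v j * eval y (pderiv j f) : ℝ) : ℂ) * Complex.I / 2 := by
      intro j
      rw [Polynomial.eval_mul, hge]
      simp_rw [hg1]
      rw [hFdef, pderiv_map, hev]
      simp [g]; ring
    simp_rw [this]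
    rw [Finset.sum_sub_distrib, ← Finset.sum_div, ← Finset.sum_div, ← Finset.sum_mul,
      ← Complex.ofReal_sum, ← Complex.ofReal_sum, hEuler]
    push_cast; ring
  have hfin : ∑ k ∈ Finset.range d, (b k : ℂ) * Q.eval (Complex.exp (s k * Complex.I) ^ 2)
      = ((∑ j, v j * eval y (pderiv j f) : ℝ) : ℂ) * Complex.I := by
    rw [hQid, hQ', hQ1]; ring
  have hbs : ∑ k ∈ Finset.range d, b k = d := by
    have := hj 0 (Nat.zero_le _)
    simp at this
    exact_mod_cast this
  calc |∑ j, v j * eval y (pderiv j f)|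
      = ‖((∑ j, v j * eval y (pderiv j f) : ℝ) : ℂ) * Complex.I‖ := by
        rw [norm_mul, Complex.norm_I, mul_one, Complex.norm_real, Real.norm_eq_abs]
    _ = ‖∑ k ∈ Finset.range d, (b k : ℂ) * Q.eval (Complex.exp (s k * Complex.I) ^ 2)‖ := by
        rw [hfin]
    _ ≤ ∑ k ∈ Finset.range d, b k * M := by
        refine (norm_sum_le _ _).trans (Finset.sum_le_sum fun k _ => ?_)
        rw [norm_mul, Complex.norm_real, Real.norm_eq_abs, abs_of_nonneg (hb k)]
        exact mul_le_mul_of_nonneg_left (hQn _) (hb k)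
    _ = d * M := by rw [← Finset.sum_mul, hbs]

/-- Linear form with coefficients `a`. -/
noncomputable def linF {σ : Type*} [Fintype σ] (a : σ → ℝ) : MvPolynomial σ ℝ := ∑ k, C (a k) * X k

theorem pderiv_linF {σ : Type*} [Fintype σ] (a : σ → ℝ) (j : σ) : pderiv j (linF a) = C (a j) := by
  classical
  unfold linF
  rw [map_sum, Finset.sum_eq_single j]
  · rw [pderiv_C_mul, pderiv_X_self, mul_one]
  · intro b _ hb
    rw [pderiv_C_mul, pderiv_X_of_ne hb, mul_zero]
  · simp

theorem eval_linF {σ : Type*} [Fintype σ] (a x : σ → ℝ) : eval x (linF a) = ∑ k, a k * x k := by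
  simp [linF]

theorem linF_hom {σ : Type*} [Fintype σ] (a : σ → ℝ) : (linF a).IsHomogeneous 1 := by
  unfold linF
  refine IsHomogeneous.sum _ _ _ fun k _ => ?_
  simpa using (isHomogeneous_C σ (a k)).mul (isHomogeneous_X ℝ k)

theorem pderiv_swap {σ : Type*} (f : MvPolynomial σ ℝ) (i j : σ) :
    pderiv i (pderiv j f) = pderiv j (pderiv i f) := by
  classical
  have h : ⁅pderiv (R := ℝ) i, pderiv (R := ℝ) j⁆ = 0 := by
    apply MvPolynomial.derivation_ext
    intro k
    rw [Derivation.commutator_apply]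
    simp only [pderiv_X, Pi.single_apply]
    split_ifs <;> simp
  have h2 := congrArg (fun D => D f) h
  simp only [Derivation.commutator_apply] at h2
  exact sub_eq_zero.1 h2

theorem hasDerivAt_eval {σ : Type*} [Fintype σ] (f : MvPolynomial σ ℝ) (c : ℝ → σ → ℝ)
    (c' : σ → ℝ) (t : ℝ) (hc : ∀ j, HasDerivAt (fun t => c t j) (c' j) t) :
    HasDerivAt (fun t => eval (c t) f) (∑ j, c' j * eval (c t) (pderiv j f)) t := by
  classical
  induction f using MvPolynomial.induction_on with
  | C a => simpa using hasDerivAt_const t a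
  | add p q hp hq =>
    simpa [mul_add, Finset.sum_add_distrib] using hp.fun_add hq
  | mul_X p i hp =>
    have h : ∀ j, c' j * eval (c t) (pderiv j (p * X i)) =
        (c' j * eval (c t) (pderiv j p)) * c t i +
          if j = i then eval (c t) p * c' j else 0 := by
      intro j
      rw [pderiv_mul, map_add, map_mul, map_mul, eval_X]
      split_ifs with hji
      · subst hji
        rw [pderiv_X_self, map_one]; ring
      · rw [pderiv_X_of_ne (Ne.symm hji), map_zero]; ring
    rw [Finset.sum_congr rfl (fun j _ => h j), Finset.sum_add_distrib, ← Finset.sum_mul]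
    simpa using hp.fun_mul (hc i)

/-- Euclidean Hessian form. -/
noncomputable def hes {σ : Type*} [Fintype σ] (f : MvPolynomial σ ℝ) (y v w : σ → ℝ) : ℝ :=
  ∑ j, ∑ k, v j * w k * eval y (pderiv j (pderiv k f))

/-- Directional derivative. -/
noncomputable def dir {σ : Type*} [Fintype σ] (f : MvPolynomial σ ℝ) (y w : σ → ℝ) : ℝ :=
  ∑ j, w j * eval y (pderiv j f)

theorem hes_polar {σ : Type*} [Fintype σ] (f : MvPolynomial σ ℝ) (y v w : σ → ℝ) :
    hes f y (fun j => v j + w j) (fun j => v j + w j) -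
      hes f y (fun j => v j - w j) (fun j => v j - w j) = 4 * hes f y v w := by
  have h1 : hes f y w v = hes f y v w := by
    unfold hes
    rw [Finset.sum_comm]
    refine Finset.sum_congr rfl fun j _ => Finset.sum_congr rfl fun k _ => ?_
    rw [pderiv_swap]; ring
  have h2 : hes f y (fun j => v j + w j) (fun j => v j + w j) -
      hes f y (fun j => v j - w j) (fun j => v j - w j) = 2 * hes f y v w + 2 * hes f y w v := by
    unfold hes
    simp only [Finset.mul_sum, ← Finset.sum_sub_distrib, ← Finset.sum_add_distrib]
    refine Finset.sum_congr rfl fun j _ => Finset.sum_congr rfl fun k _ => ?_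
    ring
  rw [h2, h1]; ring

theorem hes_scale {σ : Type*} [Fintype σ] (f : MvPolynomial σ ℝ) (y v : σ → ℝ) (r : ℝ) :
    hes f y (fun j => r * v j) (fun j => r * v j) = r ^ 2 * hes f y v v := by
  unfold hes
  simp only [Finset.mul_sum]
  refine Finset.sum_congr rfl fun j _ => Finset.sum_congr rfl fun k _ => ?_
  ring

theorem hes_unit {σ : Type*} [Fintype σ] (f : MvPolynomial σ ℝ) (d : ℕ) (hd : 1 ≤ d)
    (hf : f.IsHomogeneous d) (M : ℝ) (hM : ∀ x : σ → ℝ, x ⬝ᵥ x = 1 → |eval x f| ≤ M)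
    (y v : σ → ℝ) (hy : y ⬝ᵥ y = 1) (hv : v ⬝ᵥ v = 1) (hyv : y ⬝ᵥ v = 0) :
    |hes f y v v - dir f y y| ≤ d * (d * M) := by
  have hvy : v ⬝ᵥ y = 0 := by rw [dotProduct_comm]; exact hyv
  let G : MvPolynomial σ ℝ := ∑ k, pderiv k f * (C (v k) * linF y - C (y k) * linF v)
  have hG : G.IsHomogeneous d := by
    refine IsHomogeneous.sum _ _ _ fun k _ => ?_
    have h1 : (pderiv k f).IsHomogeneous (d - 1) := hf.pderiv
    have h2 : (C (v k) * linF y - C (y k) * linF v).IsHomogeneous 1 := by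
      refine IsHomogeneous.sub ?_ ?_
      · simpa using (isHomogeneous_C σ (v k)).mul (linF_hom y)
      · simpa using (isHomogeneous_C σ (y k)).mul (linF_hom v)
    have := h1.mul h2
    rwa [Nat.sub_add_cancel hd] at this
  have hexp : ∀ a b a' b' : ℝ, (fun j => a * y j + b * v j) ⬝ᵥ (fun j => a' * y j + b' * v j)
      = a * a' + b * b' := by
    intro a b a' b'
    change (a • y + b • v) ⬝ᵥ (a' • y + b' • v) = _
    simp only [add_dotProduct, dotProduct_add, smul_dotProduct, dotProduct_smul, hy, hv, hyv, hvy,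
      smul_eq_mul]
    ring
  have hexp1 : ∀ a b : ℝ, ∑ k, y k * (a * y k + b * v k) = a := by
    intro a b
    change y ⬝ᵥ (a • y + b • v) = _
    simp [dotProduct_add, dotProduct_smul, hy, hyv]
  have hexp2 : ∀ a b : ℝ, ∑ k, v k * (a * y k + b * v k) = b := by
    intro a b
    change v ⬝ᵥ (a • y + b • v) = _
    simp [dotProduct_add, dotProduct_smul, hv, hvy]
  have hGev : ∀ a b : ℝ, a ^ 2 + b ^ 2 = 1 → |eval (fun j => a * y j + b * v j) G| ≤ d * M := by
    intro a b hab
    have h := bernstein_circle f d hd hf (fun j => a * y j + b * v j)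
      (fun j => (-b) * y j + a * v j) M (by
        intro a' b' hab'
        apply hM
        have h1 : (fun j => a' * (a * y j + b * v j) + b' * ((-b) * y j + a * v j)) =
          fun j => (a' * a - b' * b) * y j + (a' * b + b' * a) * v j := by
          funext j; ring
        rw [h1, hexp]
        linear_combination (a' ^ 2 + b' ^ 2) * hab + hab')
    convert h using 2
    simp only [G, map_sum, map_mul, map_sub, eval_C, eval_linF, hexp1, hexp2]
    refine Finset.sum_congr rfl fun k _ => ?_
    ring
  have h := bernstein_circle G d hd hG y v (d * M) hGev
  convert h using 2
  have e1 : ∑ k, y k * y k = 1 := hy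
  have e2 : ∑ k, v k * y k = 0 := hvy
  have hpd : ∀ j, eval y (pderiv j G) = ∑ k, (v k * eval y (pderiv j (pderiv k f)) +
      eval y (pderiv k f) * (v k * y j - y k * v j)) := by
    intro j
    simp only [G, map_sum]
    refine Finset.sum_congr rfl fun k _ => ?_
    rw [pderiv_mul, map_sub, pderiv_C_mul, pderiv_C_mul, pderiv_linF, pderiv_linF]
    simp only [map_add, map_mul, map_sub, eval_C, eval_linF, e1, e2]
    ring
  simp_rw [hpd, Finset.sum_add_distrib, mul_add, Finset.sum_add_distrib]
  have p1 : ∑ x, v x * ∑ k, v k * eval y (pderiv x (pderiv k f)) = hes f y v v := by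
    unfold hes
    simp only [Finset.mul_sum]
    refine Finset.sum_congr rfl fun j _ => Finset.sum_congr rfl fun k _ => ?_
    ring
  have p2 : ∑ x, v x * ∑ k, eval y (pderiv k f) * (v k * y x - y k * v x) = - dir f y y := by
    have : ∀ x, v x * ∑ k, eval y (pderiv k f) * (v k * y x - y k * v x) =
        (v x * y x) * dir f y v - (v x * v x) * dir f y y := by
      intro x
      unfold dir
      simp only [Finset.mul_sum, ← Finset.sum_sub_distrib]
      refine Finset.sum_congr rfl fun k _ => ?_
      ring
    have e3 : ∑ k, v k * v k = 1 := hv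
    simp_rw [this]
    rw [Finset.sum_sub_distrib, ← Finset.sum_mul, ← Finset.sum_mul, e2, e3]
    ring
  rw [p1, p2]; ring

theorem hes_diag {σ : Type*} [Fintype σ] (f : MvPolynomial σ ℝ) (d : ℕ) (hd : 1 ≤ d)
    (hf : f.IsHomogeneous d) (M : ℝ) (hM : ∀ x : σ → ℝ, x ⬝ᵥ x = 1 → |eval x f| ≤ M)
    (y v : σ → ℝ) (hy : y ⬝ᵥ y = 1) (hyv : y ⬝ᵥ v = 0) :
    |hes f y v v - (v ⬝ᵥ v) * dir f y y| ≤ (v ⬝ᵥ v) * (d * (d * M)) := by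
  have h0 : 0 ≤ v ⬝ᵥ v := Finset.sum_nonneg fun i _ => mul_self_nonneg _
  rcases h0.eq_or_lt with h | h
  · have : v = 0 := dotProduct_self_eq_zero.1 h.symm
    subst this
    simp [hes]
  · set r := Real.sqrt (v ⬝ᵥ v) with hr
    have hr0 : 0 < r := Real.sqrt_pos.2 h
    have hrr : r ^ 2 = v ⬝ᵥ v := Real.sq_sqrt h0
    have h1 := hes_unit f d hd hf M hM y (fun j => r⁻¹ * v j) hy (by
      change (r⁻¹ • v) ⬝ᵥ (r⁻¹ • v) = 1
      rw [smul_dotProduct, dotProduct_smul, ← hrr, smul_eq_mul, smul_eq_mul]; field_simp) (by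
      change y ⬝ᵥ (r⁻¹ • v) = 0
      rw [dotProduct_smul, hyv, smul_zero])
    rw [hes_scale] at h1
    have h2 : hes f y v v - (v ⬝ᵥ v) * dir f y y = r ^ 2 * (r⁻¹ ^ 2 * hes f y v v - dir f y y) := by
      rw [← hrr]; field_simp
    rw [h2, abs_mul, abs_of_nonneg (sq_nonneg r), ← hrr]
    exact mul_le_mul_of_nonneg_left h1 (sq_nonneg r)

theorem hes_bound {σ : Type*} [Fintype σ] (f : MvPolynomial σ ℝ) (d : ℕ) (hd : 1 ≤ d)
    (hf : f.IsHomogeneous d) (M : ℝ) (hM : ∀ x : σ → ℝ, x ⬝ᵥ x = 1 → |eval x f| ≤ M)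
    (y v w : σ → ℝ) (hy : y ⬝ᵥ y = 1) (hyv : y ⬝ᵥ v = 0) (hyw : y ⬝ᵥ w = 0)
    (hv : v ⬝ᵥ v = 1) (hw : w ⬝ᵥ w ≤ 1) :
    |hes f y v w - (v ⬝ᵥ w) * dir f y y| ≤ d * (d * M) := by
  have hM0 : 0 ≤ M := (abs_nonneg _).trans (hM y hy)
  have hK : 0 ≤ d * (d * M) := by positivity
  have h1 := hes_diag f d hd hf M hM y (v + w) hy (by rw [dotProduct_add, hyv, hyw, add_zero])
  have h2 := hes_diag f d hd hf M hM y (v - w) hy (by rw [dotProduct_sub, hyv, hyw, sub_zero])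
  have h3 : hes f y (v + w) (v + w) - hes f y (v - w) (v - w) = 4 * hes f y v w :=
    hes_polar f y v w
  have h4 : (v + w) ⬝ᵥ (v + w) = v ⬝ᵥ v + 2 * (v ⬝ᵥ w) + w ⬝ᵥ w := by
    rw [add_dotProduct, dotProduct_add, dotProduct_add, dotProduct_comm w v]; ring
  have h5 : (v - w) ⬝ᵥ (v - w) = v ⬝ᵥ v - 2 * (v ⬝ᵥ w) + w ⬝ᵥ w := by
    rw [sub_dotProduct, dotProduct_sub, dotProduct_sub, dotProduct_comm w v]; ring
  rw [h4, hv] at h1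
  rw [h5, hv] at h2
  rw [abs_le] at h1 h2 ⊢
  have h6 : (w ⬝ᵥ w) * (d * (d * M)) ≤ 1 * (d * (d * M)) := mul_le_mul_of_nonneg_right hw hK
  constructor <;> nlinarith [h1.1, h1.2, h2.1, h2.2]

/-- Lipschitz bounds along the great circle. -/
theorem circle_value {σ : Type*} [Fintype σ] (f : MvPolynomial σ ℝ) (d : ℕ) (hd : 1 ≤ d)
    (hf : f.IsHomogeneous d) (M : ℝ) (hM : ∀ x : σ → ℝ, x ⬝ᵥ x = 1 → |eval x f| ≤ M)
    (y v : σ → ℝ) (hy : y ⬝ᵥ y = 1) (hyv : y ⬝ᵥ v = 0) (hv : v ⬝ᵥ v = 1)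
    (θ : ℝ) (hθ : 0 ≤ θ) :
    |eval (fun j => Real.cos θ * y j + Real.sin θ * v j) f - eval y f| ≤ d * M * θ := by
  have hvy : v ⬝ᵥ y = 0 := by rw [dotProduct_comm]; exact hyv
  have hder : ∀ t, HasDerivAt (fun t => eval (fun j => Real.cos t * y j + Real.sin t * v j) f)
      (∑ j, (-Real.sin t * y j + Real.cos t * v j) *
        eval (fun j => Real.cos t * y j + Real.sin t * v j) (pderiv j f)) t := by
    intro t
    apply hasDerivAt_eval f (fun t j => Real.cos t * y j + Real.sin t * v j)
    intro j
    exact ((Real.hasDerivAt_cos t).mul_const _).add ((Real.hasDerivAt_sin t).mul_const _)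
  have hb : ∀ t, ‖∑ j, (-Real.sin t * y j + Real.cos t * v j) *
        eval (fun j => Real.cos t * y j + Real.sin t * v j) (pderiv j f)‖ ≤ d * M := by
    intro t
    apply bernstein_circle f d hd hf _ (fun j => -Real.sin t * y j + Real.cos t * v j)
    intro a b hab
    apply hM
    change (a • (Real.cos t • y + Real.sin t • v) + b • (-Real.sin t • y + Real.cos t • v)) ⬝ᵥ
      (a • (Real.cos t • y + Real.sin t • v) + b • (-Real.sin t • y + Real.cos t • v)) = 1
    simp only [add_dotProduct, dotProduct_add, smul_dotProduct, dotProduct_smul, hy, hv, hyv, hvy,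
      smul_eq_mul]
    linear_combination (a ^ 2 + b ^ 2) * Real.sin_sq_add_cos_sq t + hab
  have := Convex.norm_image_sub_le_of_norm_hasDerivWithin_le (s := Set.univ)
    (fun t _ => (hder t).hasDerivWithinAt) (fun t _ => hb t) convex_univ
    (Set.mem_univ (0:ℝ)) (Set.mem_univ θ)
  simpa [abs_of_nonneg hθ] using this

theorem circle_dir {σ : Type*} [Fintype σ] (f : MvPolynomial σ ℝ) (d : ℕ) (hd : 1 ≤ d)
    (hf : f.IsHomogeneous d) (M : ℝ) (hM : ∀ x : σ → ℝ, x ⬝ᵥ x = 1 → |eval x f| ≤ M)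
    (y v w : σ → ℝ) (hy : y ⬝ᵥ y = 1) (hyv : y ⬝ᵥ v = 0) (hv : v ⬝ᵥ v = 1)
    (hyw : y ⬝ᵥ w = 0) (hw : w ⬝ᵥ w ≤ 1)
    (θ : ℝ) (hθ : 0 ≤ θ) :
    |dir f (fun j => Real.cos θ * y j + Real.sin θ * v j)
      (fun j => w j + (v ⬝ᵥ w) * (-Real.sin θ * y j + Real.cos θ * v j - v j)) - dir f y w|
      ≤ d * (d * M) * θ := by
  have hvy : v ⬝ᵥ y = 0 := by rw [dotProduct_comm]; exact hyv
  have hwy : w ⬝ᵥ y = 0 := by rw [dotProduct_comm]; exact hyw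
  have hwv : w ⬝ᵥ v = v ⬝ᵥ w := dotProduct_comm _ _
  set m := v ⬝ᵥ w with hm
  let c : ℝ → σ → ℝ := fun t j => Real.cos t * y j + Real.sin t * v j
  let c' : ℝ → σ → ℝ := fun t j => -Real.sin t * y j + Real.cos t * v j
  let W : ℝ → σ → ℝ := fun t j => w j + m * (c' t j - v j)
  have hc : ∀ t j, HasDerivAt (fun t => c t j) (c' t j) t := fun t j =>
    ((Real.hasDerivAt_cos t).mul_const _).add ((Real.hasDerivAt_sin t).mul_const _)
  have hc' : ∀ t j, HasDerivAt (fun t => c' t j) (-c t j) t := fun t j => by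
    have := ((Real.hasDerivAt_sin t).neg.mul_const (y j)).add
      ((Real.hasDerivAt_cos t).mul_const (v j))
    refine this.congr_deriv ?_
    simp only [c]; ring
  have hW : ∀ t j, HasDerivAt (fun t => W t j) (m * (-c t j)) t := fun t j =>
    (((hc' t j).sub_const (v j)).const_mul m).const_add (w j)
  have hder : ∀ t, HasDerivAt (fun t => dir f (c t) (W t))
      (hes f (c t) (c' t) (W t) - m * dir f (c t) (c t)) t := by
    intro t
    have h1 : HasDerivAt (fun t => ∑ k, W t k * eval (c t) (pderiv k f))
        (∑ k, (m * (-c t k) * eval (c t) (pderiv k f) +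
          W t k * ∑ j, c' t j * eval (c t) (pderiv j (pderiv k f)))) t := by
      apply HasDerivAt.fun_sum
      intro k _
      exact (hW t k).mul (hasDerivAt_eval (pderiv k f) c (c' t) t (hc t))
    refine h1.congr_deriv ?_
    rw [Finset.sum_add_distrib, add_comm, sub_eq_add_neg]
    congr 1
    · unfold hes
      rw [Finset.sum_comm]
      refine Finset.sum_congr rfl fun k _ => ?_
      rw [Finset.mul_sum]
      refine Finset.sum_congr rfl fun j _ => ?_
      ring
    · unfold dir
      rw [Finset.mul_sum, ← Finset.sum_neg_distrib]
      refine Finset.sum_congr rfl fun j _ => ?_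
      ring
  have hcs : ∀ t, Real.sin t ^ 2 + Real.cos t ^ 2 = 1 := Real.sin_sq_add_cos_sq
  have ec : ∀ t, c t = Real.cos t • y + Real.sin t • v := fun t => rfl
  have ec' : ∀ t, c' t = -Real.sin t • y + Real.cos t • v := fun t => rfl
  have eW : ∀ t, W t = w + m • (-Real.sin t • y + Real.cos t • v - v) := fun t => rfl
  have hb : ∀ t, ‖hes f (c t) (c' t) (W t) - m * dir f (c t) (c t)‖ ≤ d * (d * M) := by
    intro t
    have hmm : c' t ⬝ᵥ W t = m := by
      rw [ec', eW]
      simp only [add_dotProduct, dotProduct_add, sub_dotProduct, dotProduct_sub, smul_dotProduct,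
        dotProduct_smul, hy, hv, hyv, hvy, hyw, ← hm, smul_eq_mul]
      linear_combination m * hcs t
    have h := hes_bound f d hd hf M hM (c t) (c' t) (W t) ?_ ?_ ?_ ?_ ?_
    · rw [hmm] at h; exact h
    · rw [ec]
      simp only [add_dotProduct, dotProduct_add, smul_dotProduct, dotProduct_smul, hy, hv, hyv, hvy,
        smul_eq_mul]
      linear_combination hcs t
    · rw [ec, ec']
      simp only [add_dotProduct, dotProduct_add, smul_dotProduct, dotProduct_smul, hy, hv, hyv, hvy,
        smul_eq_mul]
      ring
    · rw [ec, eW]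
      simp only [add_dotProduct, dotProduct_add, sub_dotProduct, dotProduct_sub, smul_dotProduct,
        dotProduct_smul, hy, hv, hyv, hvy, hyw, ← hm, smul_eq_mul]
      ring
    · rw [ec']
      simp only [add_dotProduct, dotProduct_add, smul_dotProduct, dotProduct_smul, hy, hv, hyv, hvy,
        smul_eq_mul]
      linear_combination hcs t
    · refine le_of_eq_of_le ?_ hw
      rw [eW]
      simp only [add_dotProduct, dotProduct_add, sub_dotProduct, dotProduct_sub, smul_dotProduct,
        dotProduct_smul, hy, hv, hyv, hvy, hyw, hwy, hwv, ← hm, smul_eq_mul]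
      linear_combination m ^ 2 * hcs t
  have := Convex.norm_image_sub_le_of_norm_hasDerivWithin_le (s := Set.univ)
    (fun t _ => (hder t).hasDerivWithinAt) (fun t _ => hb t) convex_univ
    (Set.mem_univ (0:ℝ)) (Set.mem_univ θ)
  have hc0 : c 0 = y := by funext j; simp [c]
  have hW0 : W 0 = w := by funext j; simp [W, c']
  rw [hc0, hW0, Real.norm_eq_abs, Real.norm_eq_abs, sub_zero, abs_of_nonneg hθ] at this
  exact this

theorem transport_props {σ : Type*} [Fintype σ] 
    (y v w : σ → ℝ) (hy : y ⬝ᵥ y = 1) (hyv : y ⬝ᵥ v = 0) (hv : v ⬝ᵥ v = 1)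
    (hyw : y ⬝ᵥ w = 0) (t : ℝ) :
    (fun j => w j + (v ⬝ᵥ w) * (-Real.sin t * y j + Real.cos t * v j - v j)) ⬝ᵥ
      (fun j => w j + (v ⬝ᵥ w) * (-Real.sin t * y j + Real.cos t * v j - v j)) = w ⬝ᵥ w ∧
    (fun j => w j + (v ⬝ᵥ w) * (-Real.sin t * y j + Real.cos t * v j - v j)) ⬝ᵥ
      (fun j => Real.cos t * y j + Real.sin t * v j) = 0 := by
  have hvy : v ⬝ᵥ y = 0 := by rw [dotProduct_comm]; exact hyv
  have hwy : w ⬝ᵥ y = 0 := by rw [dotProduct_comm]; exact hyw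
  have hwv : w ⬝ᵥ v = v ⬝ᵥ w := dotProduct_comm _ _
  set m := v ⬝ᵥ w with hm
  constructor
  · change (w + m • (-Real.sin t • y + Real.cos t • v - v)) ⬝ᵥ
      (w + m • (-Real.sin t • y + Real.cos t • v - v)) = _
    simp only [add_dotProduct, dotProduct_add, sub_dotProduct, dotProduct_sub, smul_dotProduct,
        dotProduct_smul, hy, hv, hyv, hvy, hyw, hwy, hwv, ← hm, smul_eq_mul]
    linear_combination m ^ 2 * Real.sin_sq_add_cos_sq t
  · change (w + m • (-Real.sin t • y + Real.cos t • v - v)) ⬝ᵥ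
      (Real.cos t • y + Real.sin t • v) = _
    simp only [add_dotProduct, dotProduct_add, sub_dotProduct, dotProduct_sub, smul_dotProduct,
        dotProduct_smul, hy, hv, hyv, hvy, hyw, hwy, hwv, ← hm, smul_eq_mul]
    ring

theorem vnorm_one {m : ℕ} (x : Fin m → ℝ) : vnorm x = 1 ↔ x ⬝ᵥ x = 1 := by
  unfold vnorm
  rw [Real.sqrt_eq_one]
  simp only [dotProduct, sq]

theorem vnorm_le_one {m : ℕ} (x : Fin m → ℝ) : vnorm x ≤ 1 ↔ x ⬝ᵥ x ≤ 1 := by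
  unfold vnorm
  rw [Real.sqrt_le_left zero_le_one, one_pow]
  simp only [dotProduct, sq]

theorem vnorm_eq {m : ℕ} (x : Fin m → ℝ) : vnorm x = ‖WithLp.toLp 2 x‖ := by
  rw [EuclideanSpace.norm_eq]; simp [vnorm]

theorem vnorm_const_bound {m : ℕ} (x : Fin m → ℝ) (K : ℝ) (hK : 0 ≤ K) (h : ∀ i, |x i| ≤ K) :
    vnorm x ≤ Real.sqrt m * K := by
  unfold vnorm
  rw [← Real.sqrt_sq hK, ← Real.sqrt_mul (Nat.cast_nonneg m)]
  apply Real.sqrt_le_sqrt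
  calc ∑ j, x j ^ 2 ≤ ∑ _j : Fin m, K ^ 2 := Finset.sum_le_sum fun i _ => sq_le_sq' (abs_le.1 (h i)).1 (abs_le.1 (h i)).2
    _ = m * K ^ 2 := by simp

theorem vnorm_sub_le {m : ℕ} (a b : Fin m → ℝ) : vnorm a ≤ vnorm b + vnorm (a - b) := by
  simp only [vnorm_eq, WithLp.toLp_sub]
  have := norm_add_le (WithLp.toLp 2 b) (WithLp.toLp 2 a - WithLp.toLp 2 b)
  simpa using this

theorem cs_vnorm {m : ℕ} (u x : Fin m → ℝ) : |∑ i, u i * x i| ≤ vnorm u * vnorm x := by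
  unfold vnorm
  rw [← Real.sqrt_mul (Finset.sum_nonneg fun i _ => sq_nonneg _)]
  exact Real.abs_le_sqrt (Finset.sum_mul_sq_le_sq_mul_sq _ _ _)

theorem entry_le {m : ℕ} (x : Fin m → ℝ) (h : x ⬝ᵥ x ≤ 1) (i : Fin m) : |x i| ≤ 1 := by
  have : x i * x i ≤ x ⬝ᵥ x :=
    Finset.single_le_sum (f := fun i => x i * x i) (fun i _ => mul_self_nonneg _) (Finset.mem_univ i)
  rw [abs_le_one_iff_mul_self_le_one]; linarith

theorem supNorm_bound {n q : ℕ} (f : Fin q → MvPolynomial (Fin (n + 1)) ℝ) (i : Fin q)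
    (x : Fin (n + 1) → ℝ) (hx : x ⬝ᵥ x = 1) : |eval x (f i)| ≤ polySupNorm f := by
  have hK : IsCompact {x : Fin (n + 1) → ℝ | x ⬝ᵥ x = 1} := by
    apply Metric.isCompact_of_isClosed_isBounded
    · exact isClosed_eq (by unfold dotProduct; fun_prop) continuous_const
    · refine (Metric.isBounded_iff_subset_closedBall 0).2 ⟨1, fun z hz => ?_⟩
      rw [mem_closedBall_zero_iff]
      exact (pi_norm_le_iff_of_nonneg zero_le_one).2 fun j => entry_le z (le_of_eq hz) j
  have hC : ∀ i, ∃ B, ∀ z : Fin (n + 1) → ℝ, z ⬝ᵥ z = 1 → |eval z (f i)| ≤ B := by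
    intro i
    obtain ⟨B, hB⟩ := hK.exists_bound_of_continuousOn
      (f := fun z => eval z (f i)) (MvPolynomial.continuous_eval (f i)).continuousOn
    exact ⟨B, fun z hz => hB z hz⟩
  choose B hB using hC
  have hbd : BddAbove (Set.range fun z : {x : Fin (n + 1) → ℝ // vnorm x = 1} =>
      ⨆ i : Fin q, |eval z.1 (f i)|) := by
    refine ⟨∑ i, |B i|, ?_⟩
    rintro _ ⟨z, rfl⟩
    refine Real.iSup_le (fun i => ?_) (Finset.sum_nonneg fun _ _ => abs_nonneg _)
    calc |eval z.1 (f i)| ≤ B i := hB i z.1 ((vnorm_one _).1 z.2)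
      _ ≤ |B i| := le_abs_self _
      _ ≤ _ := Finset.single_le_sum (f := fun i => |B i|) (fun _ _ => abs_nonneg _) (Finset.mem_univ i)
  calc |eval x (f i)| ≤ ⨆ i : Fin q, |eval x (f i)| :=
        le_ciSup (f := fun i => |eval x (f i)|) (Set.finite_range _).bddAbove i
    _ ≤ polySupNorm f := le_ciSup hbd ⟨x, (vnorm_one x).2 hx⟩

theorem exists_perp (n : ℕ) (hn : 1 ≤ n) (y : Fin (n + 1) → ℝ) (hy : y ⬝ᵥ y = 1) :
    ∃ v : Fin (n + 1) → ℝ, v ⬝ᵥ v = 1 ∧ y ⬝ᵥ v = 0 := by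
  have : ∃ j, y j * y j < 1 := by
    by_contra hcon
    push Not at hcon
    have h1 : ∑ _j : Fin (n + 1), (1 : ℝ) ≤ y ⬝ᵥ y := Finset.sum_le_sum fun j _ => hcon j
    rw [hy] at h1
    simp at h1
    omega
  obtain ⟨j, hj⟩ := this
  set r := Real.sqrt (1 - y j * y j) with hr
  have hr0 : 0 < r := Real.sqrt_pos.2 (by linarith)
  have hrr : r ^ 2 = 1 - y j * y j := Real.sq_sqrt (by linarith)
  refine ⟨r⁻¹ • (Pi.single j 1 - y j • y), ?_, ?_⟩
  · simp only [smul_dotProduct, dotProduct_smul, sub_dotProduct, dotProduct_sub, hy, smul_eq_mul,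
      single_dotProduct, dotProduct_single, Pi.single_eq_same, Pi.smul_apply, Pi.sub_apply]
    field_simp
    rw [hrr]; ring
  · simp only [smul_dotProduct, dotProduct_smul, sub_dotProduct, dotProduct_sub, hy, smul_eq_mul,
      single_dotProduct, dotProduct_single]
    ring

theorem exists_geo (n : ℕ) (hn : 1 ≤ n) (y y' : Fin (n + 1) → ℝ) (hy : y ⬝ᵥ y = 1)
    (hy' : y' ⬝ᵥ y' = 1) :
    ∃ v : Fin (n + 1) → ℝ, v ⬝ᵥ v = 1 ∧ y ⬝ᵥ v = 0 ∧
      y' = fun j => Real.cos (Real.arccos (y ⬝ᵥ y')) * y j + Real.sin (Real.arccos (y ⬝ᵥ y')) * v j := by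
  have hcs : |y ⬝ᵥ y'| ≤ 1 := by
    have := cs_vnorm y y'
    rwa [(vnorm_one y).2 hy, (vnorm_one y').2 hy', mul_one] at this
  obtain ⟨h1, h2⟩ := abs_le.1 hcs
  rw [Real.cos_arccos h1 h2, Real.sin_arccos]
  set a := y ⬝ᵥ y' with ha
  have ha' : y' ⬝ᵥ y = a := dotProduct_comm _ _
  have hp : 0 ≤ 1 - a ^ 2 := by nlinarith
  have hz : (y' - a • y) ⬝ᵥ (y' - a • y) = 1 - a ^ 2 := by
    simp only [smul_dotProduct, dotProduct_smul, sub_dotProduct, dotProduct_sub, hy, hy', ← ha, ha',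
      smul_eq_mul]
    ring
  rcases hp.eq_or_lt with h | h
  · obtain ⟨v, hv, hyv⟩ := exists_perp n hn y hy
    refine ⟨v, hv, hyv, ?_⟩
    rw [← h] at hz
    have := dotProduct_self_eq_zero.1 hz
    rw [← h, Real.sqrt_zero]
    rw [sub_eq_zero] at this
    rw [this]
    funext j
    simp
  · set r := Real.sqrt (1 - a ^ 2) with hr
    have hr0 : 0 < r := Real.sqrt_pos.2 h
    have hrr : r ^ 2 = 1 - a ^ 2 := Real.sq_sqrt hp
    refine ⟨r⁻¹ • (y' - a • y), ?_, ?_, ?_⟩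
    · rw [smul_dotProduct, dotProduct_smul, hz, ← hrr, smul_eq_mul, smul_eq_mul]; field_simp
    · rw [dotProduct_smul, dotProduct_sub, dotProduct_smul, hy, ← ha]; simp
    · funext j
      simp
      field_simp
      ring

theorem Phi_le (n q : ℕ) (hn : 1 ≤ n) (hq : 1 ≤ q)
    (d : Fin q → ℕ) (hd : ∀ i, 1 ≤ d i) (D : ℕ) (hD : D = Finset.univ.sup d)
    (f : Fin q → MvPolynomial (Fin (n + 1)) ℝ) (hf : ∀ i, (f i).IsHomogeneous (d i))
    (y y' : Fin (n + 1) → ℝ) (hy : vnorm y = 1) (hy' : vnorm y' = 1) :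
    Phi d y f ≤ Phi d y' f +
      Real.sqrt q * (D * polySupNorm f * Real.arccos (∑ j, y j * y' j)) := by
  rw [vnorm_one] at hy hy'
  change _ ≤ _ + Real.sqrt q * (D * polySupNorm f * Real.arccos (y ⬝ᵥ y'))
  obtain ⟨v, hv, hyv, hgeo⟩ := exists_geo n hn y y' hy hy'
  set θ := Real.arccos (y ⬝ᵥ y') with hθdef
  have hθ : 0 ≤ θ := Real.arccos_nonneg _
  have hM := supNorm_bound f
  set M := polySupNorm f with hMdef
  have hM0 : 0 ≤ M := (abs_nonneg _).trans (hM ⟨0, hq⟩ y hy)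
  have hdD : ∀ i, (d i : ℝ) ≤ D := fun i => by
    rw [hD]; exact_mod_cast Finset.le_sup (f := d) (Finset.mem_univ i)
  have hK0 : 0 ≤ D * M * θ := by positivity
  have hdK : ∀ i, d i * M * θ ≤ D * M * θ := fun i => by
    have := hdD i
    gcongr
  unfold Phi
  rw [← max_add_add_right]
  apply max_le_max
  · refine (vnorm_sub_le _ (fun i => eval y' (f i))).trans ?_
    gcongr
    refine vnorm_const_bound _ _ hK0 fun i => ?_
    have h := circle_value (f i) (d i) (hd i) (hf i) M (hM i) y v hy hyv hv θ hθ
    rw [← hgeo, abs_sub_comm] at h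
    exact h.trans (hdK i)
  · unfold sigmaMin
    haveI : Nonempty {u : Fin q → ℝ // vnorm u = 1} :=
      ⟨⟨Pi.single ⟨0, hq⟩ 1, by rw [vnorm_one]; simp⟩⟩
    rw [← sub_le_iff_le_add]
    refine le_ciInf fun u => ?_
    rw [sub_le_iff_le_add]
    refine (ciInf_le ⟨0, ?_⟩ u).trans ?_
    · rintro _ ⟨u, rfl⟩
      exact Real.iSup_nonneg fun _ => abs_nonneg _
    haveI : Nonempty {w : Fin (n + 1) → ℝ // vnorm w ≤ 1 ∧ ∑ j, w j * y j = 0} :=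
      ⟨⟨0, by simp [vnorm], by simp⟩⟩
    refine ciSup_le fun w => ?_
    obtain ⟨w, hw1, hw2⟩ := w
    have hw : w ⬝ᵥ w ≤ 1 := (vnorm_le_one w).1 hw1
    have hyw : y ⬝ᵥ w = 0 := by rw [dotProduct_comm]; exact hw2
    obtain ⟨t1, t2⟩ := transport_props y v w hy hyv hv hyw θ
    have hcd := fun i => circle_dir (f i) (d i) (hd i) (hf i) M (hM i) y v w hy hyv hv hyw hw θ hθ
    rw [← hgeo] at t2 hcd
    set w' : Fin (n + 1) → ℝ :=
      fun j => w j + (v ⬝ᵥ w) * (-Real.sin θ * y j + Real.cos θ * v j - v j) with hw'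
    have hbdd : BddAbove (Set.range fun w : {w : Fin (n + 1) → ℝ // vnorm w ≤ 1 ∧ ∑ j, w j * y' j = 0} =>
        |∑ i, u.1 i * ((d i : ℝ)⁻¹ * ∑ j, w.1 j * eval y' (pderiv j (f i)))|) := by
      refine ⟨∑ i, |u.1 i| * ((d i : ℝ)⁻¹ * ∑ j, |eval y' (pderiv j (f i))|), ?_⟩
      rintro _ ⟨z, rfl⟩
      refine (Finset.abs_sum_le_sum_abs _ _).trans (Finset.sum_le_sum fun i _ => ?_)
      rw [abs_mul, abs_mul, abs_of_nonneg (a := (d i : ℝ)⁻¹) (inv_nonneg.2 (Nat.cast_nonneg (d i)))]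
      gcongr
      refine (Finset.abs_sum_le_sum_abs _ _).trans (Finset.sum_le_sum fun j _ => ?_)
      rw [abs_mul]
      exact mul_le_of_le_one_left (abs_nonneg _) (entry_le _ ((vnorm_le_one _).1 z.2.1) j)
    have hle := le_ciSup hbdd ⟨w', (vnorm_le_one _).2 (by rw [t1]; exact hw), t2⟩
    refine le_trans ?_ (add_le_add_left hle _)
    change |∑ i, u.1 i * ((d i : ℝ)⁻¹ * dir (f i) y w)| ≤
      |∑ i, u.1 i * ((d i : ℝ)⁻¹ * dir (f i) y' w')| + _
    have hdiff : |∑ i, u.1 i * ((d i : ℝ)⁻¹ * (dir (f i) y w - dir (f i) y' w'))| ≤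
        Real.sqrt q * (D * M * θ) := by
      refine (cs_vnorm _ _).trans ?_
      rw [u.2, one_mul]
      refine vnorm_const_bound _ _ hK0 fun i => ?_
      refine le_trans ?_ (hdK i)
      have hdi : (0 : ℝ) < d i := by exact_mod_cast hd i
      change |(d i : ℝ)⁻¹ * (dir (f i) y w - dir (f i) y' w')| ≤ _
      rw [abs_mul, abs_of_nonneg (inv_nonneg.2 hdi.le), abs_sub_comm, inv_mul_le_iff₀ hdi]
      refine (hcd i).trans (le_of_eq ?_)
      ring
    have hsplit : ∑ i, u.1 i * ((d i : ℝ)⁻¹ * dir (f i) y w) =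
        ∑ i, u.1 i * ((d i : ℝ)⁻¹ * dir (f i) y' w') +
        ∑ i, u.1 i * ((d i : ℝ)⁻¹ * (dir (f i) y w - dir (f i) y' w')) := by
      rw [← Finset.sum_add_distrib]
      exact Finset.sum_congr rfl fun i _ => by ring
    rw [hsplit]
    exact (abs_add_le _ _).trans (add_le_add_right hdiff _)

/-- Theorem 3.2, 2nd Lipschitz property: `y ↦ 1/K(f,y)` is `D`-Lipschitz with respect to
the geodesic distance `dist_S(y,ỹ) = arccos⟨y,ỹ⟩` on the sphere. -/
theorem second_lipschitz_property (n q : ℕ) (hn : 1 ≤ n) (hq : 1 ≤ q) (hqn : q ≤ n)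
    (d : Fin q → ℕ) (hd : ∀ i, 1 ≤ d i) (D : ℕ) (hD : D = Finset.univ.sup d)
    (f : Fin q → MvPolynomial (Fin (n + 1)) ℝ) (hf : ∀ i, (f i).IsHomogeneous (d i))
    (hf0 : f ≠ 0)
    (y y' : Fin (n + 1) → ℝ) (hy : vnorm y = 1) (hy' : vnorm y' = 1) :
    |Phi d y f / (Real.sqrt q * polySupNorm f) -
      Phi d y' f / (Real.sqrt q * polySupNorm f)| ≤
      (D : ℝ) * Real.arccos (∑ j, y j * y' j) := by
  have h1 := Phi_le n q hn hq d hd D hD f hf y y' hy hy'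
  have h2 := Phi_le n q hn hq d hd D hD f hf y' y hy' hy
  have hsym : ∑ j, y' j * y j = ∑ j, y j * y' j := Finset.sum_congr rfl fun _ _ => mul_comm _ _
  rw [hsym] at h2
  have hM0 : 0 ≤ polySupNorm f :=
    (abs_nonneg _).trans (supNorm_bound f ⟨0, hq⟩ y ((vnorm_one y).1 hy))
  have hθ : 0 ≤ Real.arccos (∑ j, y j * y' j) := Real.arccos_nonneg _
  rw [← sub_div]
  have hK : 0 ≤ Real.sqrt q * polySupNorm f := mul_nonneg (Real.sqrt_nonneg _) hM0
  rcases hK.eq_or_lt with h | h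
  · rw [← h]; simp; positivity
  · rw [abs_div, abs_of_pos h, div_le_iff₀ h, abs_le]
    constructor <;> nlinarith
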